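/- arXiv:2310.13672 — 6 statements merged into one kernel-verified Lean document; each statement's English description precedes it below -/
import Mathlib

section
/- The number of 1's appearing in all the partitions of n (i.e., the sum over all partitions of n of the multiplicity of the part 1) is equal to the number of distinct part sizes appearing, summed over all partitions of n (i.e., the sum over all partitions of n of the number of distinct values occurring as parts). -/
namespace Nat.Partition

/-- Exchange the submultiset `s` of the parts of a partition for a multiset `t` of positive
integers with the same sum. -/
def exchange {n : ℕ} (P : n.Partition) (s t : Multiset ℕ) (hs : s ≤ P.parts)
    (ht : ∀ i ∈ t, 0 < i) (hst : s.sum = t.sum) : n.Partition where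
  parts := P.parts - s + t
  parts_pos {i} hi := by
    rcases Multiset.mem_add.1 hi with h | h
    · exact P.parts_pos (Multiset.mem_of_le tsub_le_self h)
    · exact ht i h
  parts_sum := by
    rw [Multiset.sum_add, ← hst, ← Multiset.sum_add, tsub_add_cancel_of_le hs, P.parts_sum]

/-- The number of partitions of `n` containing a given multiset of positive integers depends only
on the sum of that multiset. -/
theorem card_filter_le_parts_congr (n : ℕ) {s t : Multiset ℕ} (hs : ∀ i ∈ s, 0 < i)
    (ht : ∀ i ∈ t, 0 < i) (hst : s.sum = t.sum) :
    (Finset.univ.filter fun P : n.Partition => s ≤ P.parts).card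
      = (Finset.univ.filter fun P : n.Partition => t ≤ P.parts).card := by
  refine Finset.card_bij'
    (fun P hP => P.exchange s t (Finset.mem_filter.1 hP).2 ht hst)
    (fun P hP => P.exchange t s (Finset.mem_filter.1 hP).2 hs hst.symm) ?_ ?_ ?_ ?_
  · intro P _
    simp [exchange]
  · intro P _
    simp [exchange]
  · intro P hP
    ext1
    simp [exchange, tsub_add_cancel_of_le (Finset.mem_filter.1 hP).2]
  · intro P hP
    ext1
    simp [exchange, tsub_add_cancel_of_le (Finset.mem_filter.1 hP).2]

theorem count_one_le {n : ℕ} (P : n.Partition) : P.parts.count 1 ≤ n := by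
  obtain ⟨u, hu⟩ := Multiset.le_iff_exists_add.1
    (Multiset.le_count_iff_replicate_le.1 (le_refl (P.parts.count 1)))
  have h := congrArg Multiset.sum hu
  simp only [P.parts_sum, Multiset.sum_add, Multiset.sum_replicate, smul_eq_mul, mul_one] at h
  omega

theorem count_one_eq_card {n : ℕ} (P : n.Partition) :
    P.parts.count 1
      = ((Finset.Icc 1 n).filter fun k => Multiset.replicate k 1 ≤ P.parts).card := by
  have h : ((Finset.Icc 1 n).filter fun k => Multiset.replicate k 1 ≤ P.parts)
      = Finset.Icc 1 (P.parts.count 1) := by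
    ext k
    have := P.count_one_le
    simp only [Finset.mem_filter, Finset.mem_Icc, ← Multiset.le_count_iff_replicate_le]
    omega
  simp [h]

theorem card_toFinset_parts_eq_card {n : ℕ} (P : n.Partition) :
    P.parts.toFinset.card = ((Finset.Icc 1 n).filter fun k => {k} ≤ P.parts).card := by
  congr 1
  ext k
  simp only [Multiset.mem_toFinset, Finset.mem_filter, Finset.mem_Icc, Multiset.singleton_le]
  exact ⟨fun h => ⟨⟨P.parts_pos h, le_of_mem_parts h⟩, h⟩, fun h => h.2⟩

end Nat.Partition

/-- The number of 1's appearing in all the partitions of `n`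
equals the number of distinct part sizes appearing, summed over all
partitions of `n`. -/
theorem stanley_theorem (n : ℕ) (hn : 0 < n) :
    ∑ P : n.Partition, Multiset.count 1 P.parts
      = ∑ P : n.Partition, P.parts.toFinset.card := by
  simp only [Nat.Partition.count_one_eq_card, Nat.Partition.card_toFinset_parts_eq_card,
    Finset.card_filter]
  rw [Finset.sum_comm, Finset.sum_comm (s := Finset.univ)]
  simp only [← Finset.card_filter]
  refine Finset.sum_congr rfl fun k hk => ?_
  refine Nat.Partition.card_filter_le_parts_congr n ?_ ?_ ?_
  · intro i hi
    simp [Multiset.eq_of_mem_replicate hi]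
  · simpa [Nat.pos_iff_ne_zero, Nat.one_le_iff_ne_zero] using (Finset.mem_Icc.1 hk).1
  · simp
end

section
/- For every positive integer n, the number of 1's appearing in all the partitions of n equals the sum over k from 2 to n+1 of φ(k) multiplied by the number of parts equal to k appearing in all partitions of n+1 whose parts are all at least 2; that is, S^{(1)}_{n,1} = Σ_{k=2}^{n+1} φ(k) · S^{(2)}_{n+1,k}. -/
open Finset

/-- `S r n k` is the total number of parts equal to `k`, counted with
multiplicity, over all partitions of `n` whose parts are all at least `r`. -/
def S (r n k : ℕ) : ℕ :=
  ∑ P ∈ Finset.univ.filter (fun P : n.Partition => ∀ p ∈ P.parts, r ≤ p),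
    Multiset.count k P.parts

/-- The number of partitions of `n` whose parts are all at least `r`. -/
def partitionCount (r n : ℕ) : ℕ :=
  #{P : n.Partition | ∀ p ∈ P.parts, r ≤ p}

theorem card_partition_le_count (r m k j : ℕ) (hk : 0 < k) (hr : r ≤ k) :
    #{P : (m + j * k).Partition | (∀ p ∈ P.parts, r ≤ p) ∧ j ≤ P.parts.count k} =
      partitionCount r m := by
  refine Finset.card_bij'
    (fun P hP ↦ ⟨P.parts - Multiset.replicate j k,
      fun hi ↦ P.parts_pos (Multiset.mem_of_le (Multiset.sub_le_self _ _) hi), ?_⟩)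
    (fun Q _ ↦ ⟨Q.parts + Multiset.replicate j k, ?_, ?_⟩) ?_ ?_ ?_ ?_
  · have hle : Multiset.replicate j k ≤ P.parts :=
      Multiset.le_count_iff_replicate_le.mp (Finset.mem_filter.mp hP).2.2
    have h := congrArg Multiset.sum (Multiset.sub_add_cancel hle)
    rw [Multiset.sum_add, P.parts_sum, Multiset.sum_replicate, smul_eq_mul] at h
    exact Nat.add_right_cancel h
  · intro i hi
    rcases Multiset.mem_add.mp hi with h | h
    · exact Q.parts_pos h
    · exact (Multiset.eq_of_mem_replicate h).symm ▸ hk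
  · simp [Q.parts_sum]
  · intro P hP
    simp only [Finset.mem_filter, Finset.mem_univ, true_and] at hP ⊢
    exact fun p hp ↦ hP.1 p (Multiset.mem_of_le (Multiset.sub_le_self _ _) hp)
  · intro Q hQ
    simp only [Finset.mem_filter, Finset.mem_univ, true_and] at hQ ⊢
    refine ⟨fun p hp ↦ ?_, by simp⟩
    rcases Multiset.mem_add.mp hp with h | h
    · exact hQ p h
    · exact (Multiset.eq_of_mem_replicate h).symm ▸ hr
  · intro P hP
    exact Nat.Partition.ext (Multiset.sub_add_cancel
      (Multiset.le_count_iff_replicate_le.mp (Finset.mem_filter.mp hP).2.2))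
  · intro Q _
    exact Nat.Partition.ext (Multiset.add_sub_cancel_right)

theorem Nat.Partition.count_mul_le {n : ℕ} (P : n.Partition) (k : ℕ) :
    P.parts.count k * k ≤ n := by
  obtain ⟨t, ht⟩ := Multiset.le_iff_exists_add.mp
    (Multiset.le_count_iff_replicate_le.mp (le_refl (P.parts.count k)))
  have h := congrArg Multiset.sum ht
  rw [Multiset.sum_add, P.parts_sum, Multiset.sum_replicate, smul_eq_mul] at h
  omega

theorem Nat.Partition.count_eq_card_multiples {n : ℕ} (P : n.Partition) {k : ℕ} (hk : 0 < k) :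
    P.parts.count k = #{m ∈ Icc 1 n | k ∣ m ∧ m / k ≤ P.parts.count k} := by
  have hc := P.count_mul_le k
  generalize P.parts.count k = c at hc ⊢
  have hinj : Function.Injective (fun j ↦ j * k) := fun a b h ↦ Nat.eq_of_mul_eq_mul_right hk h
  have hcard : #((Icc 1 c).image (fun j ↦ j * k)) = c := by
    rw [Finset.card_image_of_injective _ hinj, Nat.card_Icc, Nat.add_sub_cancel]
  refine hcard.symm.trans ?_
  congr 1
  ext m
  simp only [Finset.mem_image, Finset.mem_Icc, Finset.mem_filter]
  constructor
  · rintro ⟨j, ⟨h1, h2⟩, rfl⟩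
    refine ⟨⟨Nat.mul_pos h1 hk, ?_⟩, dvd_mul_left _ _, by rwa [Nat.mul_div_cancel _ hk]⟩
    exact (Nat.mul_le_mul_right k h2).trans hc
  · rintro ⟨⟨h1, -⟩, hd, h2⟩
    exact ⟨m / k, ⟨Nat.div_pos (Nat.le_of_dvd h1 hd) hk, h2⟩, Nat.div_mul_cancel hd⟩

theorem S_eq_sum_multiples (r n k : ℕ) (hk : 0 < k) (hr : r ≤ k) :
    S r n k = ∑ m ∈ Icc 1 n with k ∣ m, partitionCount r (n - m) := by
  unfold S
  rw [Finset.sum_congr rfl fun P _ ↦ P.count_eq_card_multiples hk]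
  simp_rw [← Finset.filter_filter, Finset.card_filter _ (Finset.filter _ _)]
  rw [Finset.sum_comm]
  refine Finset.sum_congr rfl fun m hm ↦ ?_
  obtain ⟨hm, c, rfl⟩ := Finset.mem_filter.mp hm
  obtain ⟨a, rfl⟩ := Nat.exists_eq_add_of_le' (Finset.mem_Icc.mp hm).2
  rw [← Finset.card_filter, Finset.filter_filter, Nat.add_sub_cancel, Nat.mul_div_cancel_left _ hk,
    mul_comm k c]
  exact card_partition_le_count r a k c hk hr

theorem partitionCount_one_succ (n : ℕ) :
    partitionCount 1 (n + 1) = partitionCount 1 n + partitionCount 2 (n + 1) := by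
  have h := card_partition_le_count 1 n 1 1 one_pos le_rfl
  rw [one_mul] at h
  rw [← h]
  unfold partitionCount
  rw [← Finset.card_filter_add_card_filter_not (fun P : (n + 1).Partition ↦ 1 ≤ P.parts.count 1),
    Finset.filter_filter, Finset.filter_filter]
  congr 2
  ext P
  simp only [Finset.mem_filter, Finset.mem_univ, true_and, Multiset.one_le_count_iff_mem]
  constructor
  · rintro ⟨h1, h2⟩ p hp
    have : p ≠ 1 := fun h ↦ h2 (h ▸ hp)
    have := h1 p hp
    omega
  · exact fun h ↦ ⟨fun p hp ↦ (h p hp).trans' one_le_two, fun h1 ↦ absurd (h 1 h1) (by omega)⟩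

theorem partitionCount_one_eq_sum (n : ℕ) :
    partitionCount 1 n = ∑ l ∈ range (n + 1), partitionCount 2 l := by
  induction n with
  | zero =>
    rw [Finset.sum_range_one]
    unfold partitionCount
    congr 1
  | succ n ih => rw [Finset.sum_range_succ, ← ih, partitionCount_one_succ]

theorem sum_partitionCount_one (n : ℕ) :
    ∑ i ∈ range n, partitionCount 1 i = ∑ l ∈ range (n + 1), (n - l) * partitionCount 2 l := by
  induction n with
  | zero => simp
  | succ n ih =>
    rw [Finset.sum_range_succ, ih, partitionCount_one_eq_sum, ← Finset.sum_add_distrib,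
      Finset.sum_range_succ _ (n + 1), Nat.sub_self, zero_mul, add_zero]
    refine Finset.sum_congr rfl fun l hl ↦ ?_
    rw [Nat.succ_sub (Nat.lt_succ_iff.mp (Finset.mem_range.mp hl)), Nat.succ_mul]

theorem sum_totient_dvd_Icc_two {m N : ℕ} (hm : 0 < m) (hmN : m ≤ N) :
    ∑ k ∈ Icc 2 N with k ∣ m, Nat.totient k = m - 1 := by
  have h : {k ∈ Icc 2 N | k ∣ m} = m.divisors.erase 1 := by
    ext k
    simp only [Finset.mem_filter, Finset.mem_Icc, Finset.mem_erase, Nat.mem_divisors]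
    constructor
    · rintro ⟨⟨h1, -⟩, h2⟩
      exact ⟨by omega, h2, hm.ne'⟩
    · rintro ⟨h1, h2, -⟩
      have := Nat.le_of_dvd hm h2
      have := Nat.pos_of_dvd_of_pos h2 hm
      exact ⟨⟨by omega, by omega⟩, h2⟩
  have h1 := Finset.add_sum_erase m.divisors Nat.totient (Nat.one_mem_divisors.mpr hm.ne')
  rw [Nat.sum_totient, Nat.totient_one] at h1
  rw [h]
  omega

theorem sum_totient_mul_S_two (N : ℕ) :
    ∑ k ∈ Icc 2 N, Nat.totient k * S 2 N k =
      ∑ m ∈ Icc 1 N, (m - 1) * partitionCount 2 (N - m) := by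
  have h : ∀ k ∈ Icc 2 N, Nat.totient k * S 2 N k =
      ∑ m ∈ Icc 1 N, if k ∣ m then Nat.totient k * partitionCount 2 (N - m) else 0 := by
    intro k hk
    have hk2 := (Finset.mem_Icc.mp hk).1
    rw [S_eq_sum_multiples 2 N k (by omega) hk2, Finset.mul_sum, Finset.sum_filter]
  rw [Finset.sum_congr rfl h, Finset.sum_comm]
  refine Finset.sum_congr rfl fun m hm ↦ ?_
  obtain ⟨h1, h2⟩ := Finset.mem_Icc.mp hm
  rw [← Finset.sum_filter, ← Finset.sum_mul, sum_totient_dvd_Icc_two h1 h2]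

/-- `S^{(1)}_{n,1} = Σ_{k=2}^{n+1} φ(k) · S^{(2)}_{n+1,k}`. -/
theorem ones_eq_totient_sum (n : ℕ) (hn : 0 < n) :
    S 1 n 1 = ∑ k ∈ Finset.Icc 2 (n + 1), Nat.totient k * S 2 (n + 1) k := by
  have hIcc : ∀ N : ℕ, Icc 1 N = Ico 1 (N + 1) := fun N ↦ by ext; simp
  rw [sum_totient_mul_S_two, S_eq_sum_multiples 1 n 1 one_pos le_rfl,
    Finset.filter_true_of_mem fun m _ ↦ one_dvd m, hIcc, hIcc, Finset.sum_Ico_eq_sum_range,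
    Finset.sum_Ico_eq_sum_range, Nat.add_sub_cancel, Nat.add_sub_cancel,
    ← Finset.sum_range_reflect, ← Finset.sum_range_reflect _ (n + 1)]
  refine Eq.trans (Finset.sum_congr rfl fun i hi ↦ ?_)
    ((sum_partitionCount_one n).trans (Finset.sum_congr rfl fun l hl ↦ ?_))
  · have := Finset.mem_range.mp hi
    congr 1
    omega
  · have := Finset.mem_range.mp hl
    congr 1
    · omega
    · congr 1
      omega
end

section
/- For every nonnegative integer n, p(n) = Σ_{k=3}^{n+3} P_φ(k) · S^{(3)}_{n+3,k}, where P_φ(k) denotes the number of partitions of k into two relatively prime parts. -/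
open Finset

/-- `Pphi k` is the number of partitions of `k` into two relatively prime parts,
i.e., the number of unordered pairs `(a, b)` of positive integers with
`a + b = k` and `gcd a b = 1`. -/
def Pphi (k : ℕ) : ℕ :=
  ((Finset.Icc 1 k).filter (fun a => 2 * a ≤ k ∧ Nat.gcd a (k - a) = 1)).card

/-- Removing one copy of the part `k` matches the partitions of `n + k` that contain `k` with
the partitions of `n`. -/
theorem sum_partition_ite_mem {M : Type*} [AddCommMonoid M] (f : Multiset ℕ → M) (n : ℕ) {k : ℕ}
    (hk : 1 ≤ k) :
    ∑ P : (n + k).Partition, (if k ∈ P.parts then f P.parts else 0)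
      = ∑ Q : n.Partition, f (k ::ₘ Q.parts) := by
  rw [← Finset.sum_filter]
  refine Finset.sum_bij'
    (fun P hP => ⟨P.parts.erase k, fun h => P.parts_pos (Multiset.mem_of_mem_erase h), ?_⟩)
    (fun Q _ => ⟨k ::ₘ Q.parts, fun h => ?_, ?_⟩) ?_ ?_ ?_ ?_ ?_
  · have h := Multiset.cons_erase (Finset.mem_filter.1 hP).2
    have h2 := P.parts_sum
    rw [← h, Multiset.sum_cons] at h2
    omega
  · rcases Multiset.mem_cons.1 h with rfl | h
    · exact hk
    · exact Q.parts_pos h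
  · rw [Multiset.sum_cons, Q.parts_sum, add_comm]
  · simp
  · simp
  · intro P hP
    exact Nat.Partition.ext (Multiset.cons_erase (Finset.mem_filter.1 hP).2)
  · intro Q _
    exact Nat.Partition.ext (Multiset.erase_cons_head _ _)
  · intro P hP
    rw [Multiset.cons_erase (Finset.mem_filter.1 hP).2]

/-- The number of partitions of `n` whose parts are all at least `r`. -/
def cardPartitionsGE (r n : ℕ) : ℕ :=
  (Finset.univ.filter (fun P : n.Partition => ∀ p ∈ P.parts, r ≤ p)).card

theorem cardPartitionsGE_one (n : ℕ) : cardPartitionsGE 1 n = Fintype.card n.Partition := by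
  rw [cardPartitionsGE, Finset.filter_true_of_mem, Finset.card_univ]
  exact fun P _ p hp => P.parts_pos hp

theorem cardPartitionsGE_of_lt {r n : ℕ} (h : n < r) :
    cardPartitionsGE r n = cardPartitionsGE (r + 1) n := by
  unfold cardPartitionsGE
  congr 1
  refine Finset.filter_congr fun P _ => forall₂_congr fun p hp => ?_
  have := P.le_of_mem_parts hp
  omega

theorem cardPartitionsGE_add {r : ℕ} (hr : 1 ≤ r) (n : ℕ) :
    cardPartitionsGE r (n + r) = cardPartitionsGE (r + 1) (n + r) + cardPartitionsGE r n := by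
  have h := sum_partition_ite_mem (fun s => if ∀ p ∈ s, r ≤ p then 1 else 0) n hr
  simp only [Multiset.forall_mem_cons, le_refl, true_and] at h
  simp only [cardPartitionsGE, Finset.card_filter]
  rw [← h, ← Finset.sum_add_distrib]
  refine Finset.sum_congr rfl fun P _ => ?_
  by_cases hm : r ∈ P.parts
  · have : ¬ ∀ p ∈ P.parts, r + 1 ≤ p := fun h => by have := h r hm; omega
    rw [if_pos hm, if_neg this, zero_add]
  · have : (∀ p ∈ P.parts, r + 1 ≤ p) ↔ ∀ p ∈ P.parts, r ≤ p :=
      forall₂_congr fun p hp => by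
        have : p ≠ r := fun h => hm (h ▸ hp)
        omega
    simp only [hm, this, if_false, add_zero]

theorem S_of_lt {r n k : ℕ} (h : n < k) : S r n k = 0 := by
  refine Finset.sum_eq_zero fun P _ => Multiset.count_eq_zero.2 fun hk => ?_
  have := P.le_of_mem_parts hk
  omega

theorem S_add {r k : ℕ} (hk : 1 ≤ k) (hr : r ≤ k) (n : ℕ) :
    S r (n + k) k = S r n k + cardPartitionsGE r n := by
  have h := sum_partition_ite_mem
    (fun s => if ∀ p ∈ s, r ≤ p then Multiset.count k s else 0) n hk
  simp only [Multiset.forall_mem_cons, hr, true_and, Multiset.count_cons_self] at h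
  simp only [S, cardPartitionsGE, Finset.card_filter, Finset.sum_filter]
  rw [← Finset.sum_add_distrib]
  refine Eq.trans (Finset.sum_congr rfl fun P _ => ?_)
    (h.trans (Finset.sum_congr rfl fun Q _ => ?_))
  · by_cases hm : k ∈ P.parts
    · simp [hm]
    · simp [hm]
  · split_ifs <;> rfl

open PowerSeries in
theorem coeff_mul_one_sub_X_pow {R : Type*} [CommRing R] (f : R⟦X⟧) (k n : ℕ) :
    coeff n (f * (1 - X ^ k)) = coeff n f - if k ≤ n then coeff (n - k) f else 0 := by
  rw [mul_sub, mul_one, map_sub, coeff_mul_X_pow']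

open PowerSeries in
theorem mk_cardPartitionsGE_mul {r : ℕ} (hr : 1 ≤ r) :
    (PowerSeries.mk fun n => (cardPartitionsGE r n : ℤ)) * (1 - X ^ r)
      = PowerSeries.mk fun n => (cardPartitionsGE (r + 1) n : ℤ) := by
  ext n
  rw [coeff_mul_one_sub_X_pow]
  simp only [coeff_mk]
  split_ifs with h
  · obtain ⟨m, rfl⟩ := Nat.exists_eq_add_of_le' h
    rw [cardPartitionsGE_add hr]
    simp
  · rw [cardPartitionsGE_of_lt (not_le.1 h), sub_zero]

open PowerSeries in
theorem mk_half_mul :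
    (PowerSeries.mk fun n => (((n - 1) / 2 : ℕ) : ℤ)) * (1 - X ^ 1) * (1 - X ^ 2) = X ^ 3 := by
  ext n
  simp only [coeff_mul_one_sub_X_pow, coeff_mk, coeff_X_pow]
  split_ifs <;> omega

/-- There are as many partitions of `n` in which `k` occurs at least `j` times as there are
partitions of `n - j * k`, so `S r n k` is a sum over the positive multiples of `k`. -/
theorem S_eq_sum {r k : ℕ} (hk : 1 ≤ k) (hr : r ≤ k) (n : ℕ) :
    S r n k = ∑ x ∈ HasAntidiagonal.antidiagonal n,
      (if k ∣ x.1 ∧ x.1 ≠ 0 then 1 else 0) * cardPartitionsGE r x.2 := by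
  have hne : (1 - PowerSeries.X ^ k : PowerSeries ℤ) ≠ 0 := fun h => by
    have := congrArg (PowerSeries.coeff 0) h
    simp [zero_pow (by omega : k ≠ 0)] at this
  have hD : (PowerSeries.mk fun n => (if k ∣ n ∧ n ≠ 0 then 1 else 0 : ℤ))
      * (1 - PowerSeries.X ^ k) = PowerSeries.X ^ k := by
    ext n
    simp only [coeff_mul_one_sub_X_pow, PowerSeries.coeff_mk, PowerSeries.coeff_X_pow]
    by_cases h : k ≤ n
    · obtain ⟨m, rfl⟩ := Nat.exists_eq_add_of_le' h
      by_cases hm : m = 0 <;> by_cases hd : k ∣ m <;> simp_all <;> omega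
    · have h1 : ¬ (k ∣ n ∧ n ≠ 0) := fun h' => h (Nat.le_of_dvd (by omega) h'.1)
      rw [if_neg h1, if_neg h, if_neg (by omega), sub_zero]
  have hS : (PowerSeries.mk fun n => (S r n k : ℤ)) * (1 - PowerSeries.X ^ k)
      = (PowerSeries.mk fun n => (cardPartitionsGE r n : ℤ)) * PowerSeries.X ^ k := by
    ext n
    simp only [coeff_mul_one_sub_X_pow, PowerSeries.coeff_mk, PowerSeries.coeff_mul_X_pow']
    split_ifs with h
    · obtain ⟨m, rfl⟩ := Nat.exists_eq_add_of_le' h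
      rw [S_add hk hr]
      simp
    · simp [S_of_lt (not_le.1 h)]
  have key : (PowerSeries.mk fun n => (S r n k : ℤ))
      = (PowerSeries.mk fun n => (if k ∣ n ∧ n ≠ 0 then 1 else 0 : ℤ))
        * PowerSeries.mk fun n => (cardPartitionsGE r n : ℤ) := by
    apply mul_right_cancel₀ hne
    rw [hS, mul_right_comm, hD, mul_comm]
  have h := congrArg (PowerSeries.coeff n) key
  rw [PowerSeries.coeff_mul] at h
  simp only [PowerSeries.coeff_mk] at h
  exact_mod_cast h

theorem sum_divisors_Pphi {N : ℕ} (hN : N ≠ 0) : ∑ k ∈ N.divisors, Pphi k = N / 2 := by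
  have hcard : (Finset.Icc 1 (N / 2)).card = N / 2 := by simp
  rw [← hcard, Finset.card_eq_sum_card_fiberwise (f := fun a => N / Nat.gcd a N)
    (t := N.divisors) fun a _ => by
      simpa [hN] using Nat.div_dvd_of_dvd (Nat.gcd_dvd_right a N)]
  refine Finset.sum_congr rfl fun k hk => ?_
  obtain ⟨d, rfl⟩ := Nat.dvd_of_mem_divisors hk
  have hk0 : 0 < k := Nat.pos_of_ne_zero fun h => hN (by simp [h])
  have hd0 : 0 < d := Nat.pos_of_ne_zero fun h => hN (by simp [h])
  refine Finset.card_bij (fun b _ => b * d) ?_ ?_ ?_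
  · intro b hb
    simp only [Finset.mem_filter, Finset.mem_Icc] at hb ⊢
    obtain ⟨⟨hb1, hbk⟩, hb2, hg⟩ := hb
    rw [Nat.gcd_sub_self_right hbk] at hg
    refine ⟨⟨Nat.mul_pos hb1 hd0, ?_⟩, ?_⟩
    · rw [Nat.le_div_iff_mul_le two_pos]
      nlinarith
    · rw [Nat.gcd_mul_right, hg, one_mul, Nat.mul_div_cancel _ hd0]
  · intro b _ c _ h
    exact Nat.eq_of_mul_eq_mul_right hd0 h
  · intro a ha
    simp only [Finset.mem_filter, Finset.mem_Icc] at ha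
    obtain ⟨⟨ha1, ha2⟩, hg⟩ := ha
    have hgd : Nat.gcd a (k * d) = d := by
      have h := Nat.div_mul_cancel (Nat.gcd_dvd_right a (k * d))
      rw [hg] at h
      exact Nat.eq_of_mul_eq_mul_left hk0 h
    obtain ⟨b, rfl⟩ : d ∣ a := hgd ▸ Nat.gcd_dvd_left a (k * d)
    rw [Nat.le_div_iff_mul_le two_pos] at ha2
    have hb2 : 2 * b ≤ k := by
      refine Nat.le_of_mul_le_mul_right ?_ hd0
      linarith
    have hb1 : 1 ≤ b := Nat.pos_of_mul_pos_left ha1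
    refine ⟨b, ?_, mul_comm _ _⟩
    simp only [Finset.mem_filter, Finset.mem_Icc]
    refine ⟨⟨hb1, by omega⟩, hb2, ?_⟩
    rw [Nat.gcd_sub_self_right (by omega)]
    rw [mul_comm d b, Nat.gcd_mul_right] at hgd
    exact Nat.eq_of_mul_eq_mul_right hd0 (by rw [hgd, one_mul])

theorem Pphi_one : Pphi 1 = 0 := by decide

theorem Pphi_two : Pphi 2 = 1 := by decide

theorem sum_Icc_three_Pphi {N m : ℕ} (hN : N ≤ m) :
    ∑ k ∈ Finset.Icc 3 m, Pphi k * (if k ∣ N ∧ N ≠ 0 then 1 else 0) = (N - 1) / 2 := by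
  rcases Nat.eq_zero_or_pos N with rfl | hpos
  · simp
  have h3 : ∑ k ∈ Finset.Icc 3 m, Pphi k * (if k ∣ N ∧ N ≠ 0 then 1 else 0)
      = ∑ k ∈ N.divisors.filter (3 ≤ ·), Pphi k := by
    simp only [mul_ite, mul_one, mul_zero]
    rw [← Finset.sum_filter]
    refine Finset.sum_congr ?_ fun _ _ => rfl
    ext k
    simp only [Finset.mem_filter, Finset.mem_Icc, Nat.mem_divisors]
    constructor
    · tauto
    · rintro ⟨⟨h1, h2⟩, h3⟩
      exact ⟨⟨h3, (Nat.le_of_dvd hpos h1).trans hN⟩, h1, h2⟩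
  have h2 : ∑ k ∈ N.divisors.filter (¬ 3 ≤ ·), Pphi k = if 2 ∣ N then 1 else 0 := by
    have : ∀ k ∈ N.divisors.filter (¬ 3 ≤ ·), Pphi k = if k = 2 then 1 else 0 := by
      intro k hk
      have h0 := Nat.pos_of_mem_divisors (Finset.mem_filter.1 hk).1
      have h3 := (Finset.mem_filter.1 hk).2
      obtain rfl | rfl : k = 1 ∨ k = 2 := by omega
      · exact Pphi_one
      · exact Pphi_two
    rw [Finset.sum_congr rfl this, Finset.sum_ite_eq']
    simp [hpos.ne']
  have h := Finset.sum_filter_add_sum_filter_not N.divisors (3 ≤ ·) Pphi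
  rw [sum_divisors_Pphi hpos.ne', h2] at h
  rw [h3]
  split_ifs at h <;> omega

/-- `p(n) = Σ_{k=3}^{n+3} P_φ(k) · S^{(3)}_{n+3,k}`. -/
theorem partition_eq_halfTotient_sum (n : ℕ) :
    Fintype.card (Nat.Partition n)
      = ∑ k ∈ Finset.Icc 3 (n + 3), Pphi k * S 3 (n + 3) k := by
  have key : (PowerSeries.mk fun n => (((n - 1) / 2 : ℕ) : ℤ))
      * (PowerSeries.mk fun n => (cardPartitionsGE 3 n : ℤ))
      = (PowerSeries.mk fun n => (cardPartitionsGE 1 n : ℤ)) * PowerSeries.X ^ 3 := by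
    rw [← mk_half_mul, ← mk_cardPartitionsGE_mul (r := 2) (by norm_num),
      ← mk_cardPartitionsGE_mul (r := 1) le_rfl]
    ring
  have h := congrArg (PowerSeries.coeff (n + 3)) key
  rw [PowerSeries.coeff_mul, PowerSeries.coeff_mul_X_pow] at h
  simp only [PowerSeries.coeff_mk] at h
  rw [← cardPartitionsGE_one]
  calc cardPartitionsGE 1 n
      = ∑ x ∈ HasAntidiagonal.antidiagonal (n + 3), (x.1 - 1) / 2 * cardPartitionsGE 3 x.2 := by
        exact_mod_cast h.symm
    _ = ∑ x ∈ HasAntidiagonal.antidiagonal (n + 3), ∑ k ∈ Finset.Icc 3 (n + 3),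
          Pphi k * ((if k ∣ x.1 ∧ x.1 ≠ 0 then 1 else 0) * cardPartitionsGE 3 x.2) := by
        refine Finset.sum_congr rfl fun x hx => ?_
        have hx1 := Finset.HasAntidiagonal.mem_antidiagonal.1 hx
        rw [← sum_Icc_three_Pphi (by omega : x.1 ≤ n + 3), Finset.sum_mul]
        simp only [mul_assoc]
    _ = ∑ k ∈ Finset.Icc 3 (n + 3), Pphi k * S 3 (n + 3) k := by
        rw [Finset.sum_comm]
        refine Finset.sum_congr rfl fun k hk => ?_
        have hk3 := (Finset.mem_Icc.1 hk).1
        rw [S_eq_sum (by omega) hk3, Finset.mul_sum]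
end

section
/- For all positive integers n, k, r with k ≥ r, S^{(r)}_{n,k} = Σ_{t=1}^{⌊n/k⌋} p_r(n − t·k), where p_r(m) denotes the number of partitions of m with smallest part at least r (and p_r(0)=1). -/
open Finset

/-- `pr r m` is the number of partitions of `m` all of whose parts are at
least `r` (with `pr r 0 = 1`, the empty partition). -/
def pr (r m : ℕ) : ℕ :=
  Fintype.card {P : m.Partition // ∀ p ∈ P.parts, r ≤ p}

theorem Nat.Partition.mul_le_of_le_count {n k t : ℕ} (P : n.Partition)
    (h : t ≤ P.parts.count k) : t * k ≤ n := by
  obtain ⟨s, hs⟩ := Multiset.le_iff_exists_add.mp (Multiset.le_count_iff_replicate_le.mp h)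
  have hsum := P.parts_sum
  rw [hs, Multiset.sum_add, Multiset.sum_replicate, smul_eq_mul] at hsum
  omega

/-- Removing `t` copies of `k` identifies the partitions of `n` with parts at least `r` in which
`k` occurs at least `t` times with the partitions of `n - t * k` with parts at least `r`. -/
def Nat.Partition.removeReplicateEquiv {n k r t : ℕ} (hk : 0 < k) (hrk : r ≤ k)
    (htk : t * k ≤ n) :
    {P : n.Partition // (∀ p ∈ P.parts, r ≤ p) ∧ t ≤ P.parts.count k} ≃
      {Q : (n - t * k).Partition // ∀ p ∈ Q.parts, r ≤ p} where
  toFun P :=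
    ⟨{ parts := P.1.parts - Multiset.replicate t k
       parts_pos := fun h => P.1.parts_pos (Multiset.mem_of_le (Multiset.sub_le_self _ _) h)
       parts_sum := by
        have h := congrArg Multiset.sum
          (Multiset.sub_add_cancel (Multiset.le_count_iff_replicate_le.mp P.2.2))
        rw [Multiset.sum_add, Multiset.sum_replicate, smul_eq_mul, P.1.parts_sum] at h
        omega },
      fun p h => P.2.1 p (Multiset.mem_of_le (Multiset.sub_le_self _ _) h)⟩
  invFun Q :=
    ⟨{ parts := Q.1.parts + Multiset.replicate t k
       parts_pos := fun h => by
        rcases Multiset.mem_add.mp h with h | h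
        · exact Q.1.parts_pos h
        · exact Multiset.eq_of_mem_replicate h ▸ hk
       parts_sum := by
        rw [Multiset.sum_add, Multiset.sum_replicate, smul_eq_mul, Q.1.parts_sum]
        omega },
      fun p h => by
        rcases Multiset.mem_add.mp h with h | h
        · exact Q.2 p h
        · exact Multiset.eq_of_mem_replicate h ▸ hrk,
      by simp⟩
  left_inv P := Subtype.ext <| Nat.Partition.ext <|
    Multiset.sub_add_cancel (Multiset.le_count_iff_replicate_le.mp P.2.2)
  right_inv Q := Subtype.ext <| Nat.Partition.ext <| Multiset.add_sub_cancel_right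

theorem Nat.Partition.count_eq_sum_ite {n k : ℕ} (hk : 0 < k) (P : n.Partition) :
    P.parts.count k = ∑ t ∈ Finset.Icc 1 (n / k), if t ≤ P.parts.count k then 1 else 0 := by
  have hle : P.parts.count k ≤ n / k :=
    (Nat.le_div_iff_mul_le hk).mpr (P.mul_le_of_le_count le_rfl)
  have hfilter : (Finset.Icc 1 (n / k)).filter (· ≤ P.parts.count k) =
      Finset.Icc 1 (P.parts.count k) := by
    ext t
    simp only [Finset.mem_filter, Finset.mem_Icc]
    omega
  rw [← Finset.card_filter, hfilter, Nat.card_Icc, Nat.add_sub_cancel]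

/-- `S^{(r)}_{n,k} = Σ_{t=1}^{⌊n/k⌋} p_r(n − t·k)`. -/
theorem S_eq_sum_pr (n k r : ℕ) (hn : 0 < n) (hr : 0 < r) (hrk : r ≤ k) :
    S r n k = ∑ t ∈ Finset.Icc 1 (n / k), pr r (n - t * k) := by
  have hk : 0 < k := hr.trans_le hrk
  rw [S, Finset.sum_congr rfl fun P _ => P.count_eq_sum_ite hk, Finset.sum_comm]
  refine Finset.sum_congr rfl fun t ht => ?_
  have htk : t * k ≤ n := (Nat.le_div_iff_mul_le hk).mp (Finset.mem_Icc.mp ht).2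
  rw [← Finset.card_filter, Finset.filter_filter, ← Fintype.card_subtype, pr]
  exact Fintype.card_congr (Nat.Partition.removeReplicateEquiv hk hrk htk)
end

section
/- For every positive integer n, Σ_{k=1}^{n} k·(p(n−k) − p(n−1−k)) = p(n−1) + S^{(1)}_{n−1,1}, where p(m)=0 for m<0 and S^{(1)}_{0,1}=0. -/
/-- the partition function extended to the integers by `0` on negatives. -/
def pZ (m : ℤ) : ℤ :=
  if 0 ≤ m then (Fintype.card (Nat.Partition m.toNat) : ℤ) else 0

/-- Removing a part equal to `1` shows that the number of ones over all partitions of `m + 1`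
exceeds the number of ones over all partitions of `m` by the number of partitions of `m`. -/
theorem sum_count_one_succ (m : ℕ) :
    ∑ P : (m + 1).Partition, (Multiset.count 1 P.parts : ℤ)
      = Fintype.card m.Partition + ∑ P : m.Partition, (Multiset.count 1 P.parts : ℤ) := by
  let e : {P : (m + 1).Partition // 1 ∈ P.parts} ≃ m.Partition :=
    Nat.Partition.partitionWithPartEquiv le_rfl (Nat.le_add_left 1 m)
  have he (Q : m.Partition) : (e.symm Q).1.parts = 1 ::ₘ Q.parts :=
    Nat.Partition.partitionWithPartEquiv_symm_apply_parts le_rfl (Nat.le_add_left 1 m) Q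
  calc ∑ P : (m + 1).Partition, (Multiset.count 1 P.parts : ℤ)
      = ∑ P : (m + 1).Partition with 1 ∈ P.parts, (Multiset.count 1 P.parts : ℤ) := by
        refine (Finset.sum_filter_of_ne fun P _ hP => ?_).symm
        by_contra h
        exact hP (by simp [Multiset.count_eq_zero_of_notMem h])
    _ = ∑ P : {P : (m + 1).Partition // 1 ∈ P.parts}, (Multiset.count 1 P.1.parts : ℤ) :=
        Finset.sum_subtype _ (by simp) _
    _ = ∑ Q : m.Partition, (Multiset.count 1 (e.symm Q).1.parts : ℤ) :=
        (e.symm.sum_comp fun P => (Multiset.count 1 P.1.parts : ℤ)).symm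
    _ = Fintype.card m.Partition + ∑ P : m.Partition, (Multiset.count 1 P.parts : ℤ) := by
        simp [he, Finset.sum_add_distrib, add_comm]

theorem pZ_natCast (m : ℕ) : pZ m = Fintype.card m.Partition := by
  simp [pZ]

theorem sum_count_one_eq_sum_range (m : ℕ) :
    ∑ P : m.Partition, (Multiset.count 1 P.parts : ℤ) = ∑ j ∈ Finset.range m, pZ j := by
  induction m with
  | zero => simp
  | succ m ih => rw [sum_count_one_succ, ih, Finset.sum_range_succ, pZ_natCast, add_comm]

/-- Summation by parts for `∑ k * (f (a - k) - f (a - 1 - k))`. -/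
theorem sum_Icc_mul_sub (f : ℤ → ℤ) (a : ℤ) (N : ℕ) :
    ∑ k ∈ Finset.Icc 1 N, (k : ℤ) * (f (a - k) - f (a - 1 - k))
      = ∑ k ∈ Finset.Icc 1 N, f (a - k) - N * f (a - 1 - N) := by
  induction N with
  | zero => simp
  | succ N ih =>
    rw [Finset.sum_Icc_succ_top (by lia), Finset.sum_Icc_succ_top (by lia), ih,
      show a - ((N + 1 : ℕ) : ℤ) = a - 1 - N by push_cast; ring]
    push_cast
    ring

/-- `Σ_{k=1}^{n} k·(p(n−k) − p(n−1−k)) = p(n−1) + S^{(1)}_{n−1,1}`,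
where `p(m) = 0` for `m < 0` and `S^{(1)}_{0,1} = 0`. -/
theorem sum_k_p_diff (n : ℕ) (hn : 0 < n) :
    ∑ k ∈ Finset.Icc 1 n, (k : ℤ) * (pZ ((n : ℤ) - k) - pZ ((n : ℤ) - 1 - k))
      = pZ ((n : ℤ) - 1)
        + ∑ P : (n - 1).Partition, (Multiset.count 1 P.parts : ℤ) := by
  have hneg : pZ ((n : ℤ) - 1 - n) = 0 := if_neg (by lia)
  have hreflect : ∑ k ∈ Finset.Icc 1 n, pZ ((n : ℤ) - k) = ∑ j ∈ Finset.range n, pZ j := by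
    refine Finset.sum_nbij' (n - ·) (n - ·) ?_ ?_ ?_ ?_ ?_ <;>
      simp only [Finset.mem_Icc, Finset.mem_range] <;> lia
  rw [sum_Icc_mul_sub, hneg, hreflect, sum_count_one_eq_sum_range]
  obtain ⟨m, rfl⟩ := Nat.exists_eq_add_of_lt hn
  simp [Finset.sum_range_succ, add_comm]
end

section
/- For every positive integer n, Σ over all partitions of n that contain 1 as a part, of (m_1(λ) − 1), equals Σ over all partitions μ of n with no part equal to 1, of Σ_{k=2}^{n} φ(k)·m_k(μ); here m_k(λ) denotes the multiplicity of the part k in the partition λ. Equivalently, Σ_{1 + t_1 + 2t_2 + ⋯ + n t_n = n} t_1 = Σ_{2t_2 + ⋯ + n t_n = n} (φ(2)t_2 + ⋯ + φ(n)t_n), where the sums range over nonnegative integer solutions. -/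
open Finset

namespace Nat.Partition

/-- Removing the parts of `s` is a bijection from the partitions of `n` that contain `s`
to the partitions of `n - s.sum`. -/
theorem card_filter_le_parts_and (s : Multiset ℕ) (hs : ∀ i ∈ s, 0 < i) {n : ℕ}
    (hsn : s.sum ≤ n) (p : Multiset ℕ → Prop) [DecidablePred p] :
    #{P : n.Partition | s ≤ P.parts ∧ p (P.parts - s)} =
      #{Q : (n - s.sum).Partition | p Q.parts} := by
  symm
  refine Finset.card_bij
    (fun Q _ => ⟨Q.parts + s, fun {i} hi => ?_, ?_⟩) ?_ ?_ ?_
  · rcases Multiset.mem_add.1 hi with h | h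
    exacts [Q.parts_pos h, hs i h]
  · rw [Multiset.sum_add, Q.parts_sum, Nat.sub_add_cancel hsn]
  · intro Q hQ
    simpa using hQ
  · intro Q _ R _ h
    exact Nat.Partition.ext (by simpa using h)
  · intro P hP
    obtain ⟨hle, hp⟩ := (Finset.mem_filter.1 hP).2
    have hadd : P.parts - s + s = P.parts := tsub_add_cancel_of_le hle
    refine ⟨⟨P.parts - s, fun {i} hi => P.parts_pos (Multiset.mem_of_le tsub_le_self hi), ?_⟩,
      by simpa using hp, Nat.Partition.ext hadd⟩
    have := congrArg Multiset.sum hadd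
    rw [Multiset.sum_add, P.parts_sum] at this
    omega

theorem card_filter_count_one_eq {n m : ℕ} (hm : m ≤ n) :
    #{P : n.Partition | P.parts.count 1 = m} = #{Q : (n - m).Partition | 1 ∉ Q.parts} := by
  have h := card_filter_le_parts_and (Multiset.replicate m 1)
    (fun i hi => by simp [Multiset.eq_of_mem_replicate hi]) (n := n) (by simpa using hm)
    (fun t => 1 ∉ t)
  rw [show (Multiset.replicate m 1).sum = m by simp] at h
  rw [← h]
  congr 1
  ext P
  simp only [Finset.mem_filter, Finset.mem_univ, true_and, ← Multiset.le_count_iff_replicate_le,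
    ← Multiset.count_eq_zero, Multiset.count_sub, Multiset.count_replicate_self]
  omega

theorem card_filter_one_notMem_and_le_count {n k j : ℕ} (hk : 2 ≤ k) (hjk : j * k ≤ n) :
    #{P : n.Partition | 1 ∉ P.parts ∧ j ≤ P.parts.count k} =
      #{Q : (n - j * k).Partition | 1 ∉ Q.parts} := by
  have h := card_filter_le_parts_and (Multiset.replicate j k)
    (fun i hi => by rw [Multiset.eq_of_mem_replicate hi]; omega) (n := n) (by simpa using hjk)
    (fun t => 1 ∉ t)
  rw [show (Multiset.replicate j k).sum = j * k by simp] at h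
  rw [← h]
  congr 1
  ext P
  have hk1 : k ≠ 1 := by omega
  simp only [Finset.mem_filter, Finset.mem_univ, true_and, ← Multiset.le_count_iff_replicate_le,
    ← Multiset.count_eq_zero, Multiset.count_sub, Multiset.count_replicate, hk1, if_false,
    Nat.sub_zero]
  exact and_comm

theorem count_mul_le_s13 {n : ℕ} (P : n.Partition) (k : ℕ) : P.parts.count k * k ≤ n := by
  have h := Multiset.le_count_iff_replicate_le.1 (le_refl (P.parts.count k))
  obtain ⟨t, ht⟩ := Multiset.le_iff_exists_add.1 h
  have := congrArg Multiset.sum ht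
  rw [P.parts_sum, Multiset.sum_add, Multiset.sum_replicate, smul_eq_mul] at this
  omega

theorem count_eq_card_filter_dvd {n k : ℕ} (hk : 0 < k) (P : n.Partition) :
    P.parts.count k = #{m ∈ Icc 1 n | k ∣ m ∧ m / k ≤ P.parts.count k} := by
  have : {m ∈ Icc 1 n | k ∣ m ∧ m / k ≤ P.parts.count k} =
      (Icc 1 (P.parts.count k)).image (· * k) := by
    ext m
    simp only [Finset.mem_filter, Finset.mem_Icc, Finset.mem_image]
    constructor
    · rintro ⟨⟨h1, -⟩, ⟨j, rfl⟩, h⟩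
      rw [Nat.mul_div_cancel_left _ hk] at h
      exact ⟨j, ⟨Nat.pos_of_mul_pos_left h1, h⟩, mul_comm _ _⟩
    · rintro ⟨j, ⟨h1, h⟩, rfl⟩
      refine ⟨⟨Nat.mul_pos h1 hk, (Nat.mul_le_mul_right k h).trans (P.count_mul_le_s13 k)⟩,
        Nat.dvd_mul_left _ _, ?_⟩
      rwa [Nat.mul_div_cancel _ hk]
  rw [this, Finset.card_image_of_injective _ (mul_left_injective₀ hk.ne')]
  simp

theorem sum_count_of_one_notMem {n k : ℕ} (hk : 2 ≤ k) :
    ∑ P : n.Partition with 1 ∉ P.parts, P.parts.count k =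
      ∑ m ∈ Icc 1 n with k ∣ m, #{Q : (n - m).Partition | 1 ∉ Q.parts} := by
  have hcount (P : n.Partition) : P.parts.count k =
      ∑ m ∈ Icc 1 n with k ∣ m, if m / k ≤ P.parts.count k then 1 else 0 := by
    rw [← Finset.card_filter, Finset.filter_filter]
    exact count_eq_card_filter_dvd (by omega) P
  rw [Finset.sum_congr rfl fun P _ => hcount P, Finset.sum_comm]
  refine Finset.sum_congr rfl fun m hm => ?_
  obtain ⟨hm, hd⟩ := Finset.mem_filter.1 hm
  have hmk : m / k * k = m := Nat.div_mul_cancel hd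
  have h := card_filter_one_notMem_and_le_count (n := n) (j := m / k) hk
    (hmk.le.trans (Finset.mem_Icc.1 hm).2)
  rw [hmk] at h
  rw [← Finset.card_filter, Finset.filter_filter, h]

theorem sum_count_one_sub_one (n : ℕ) :
    ∑ P : n.Partition with 1 ∈ P.parts, (P.parts.count 1 - 1) =
      ∑ m ∈ Icc 1 n, (m - 1) * #{Q : (n - m).Partition | 1 ∉ Q.parts} := by
  rw [← Finset.sum_fiberwise_of_maps_to (g := fun P : n.Partition => P.parts.count 1)
    (t := Icc 1 n)]
  · refine Finset.sum_congr rfl fun m hm => ?_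
    obtain ⟨h1, hmn⟩ := Finset.mem_Icc.1 hm
    rw [← card_filter_count_one_eq hmn, Finset.sum_congr rfl (g := fun _ => m - 1)
      (fun P hP => by rw [(Finset.mem_filter.1 hP).2]), Finset.sum_const, smul_eq_mul, mul_comm,
      Finset.filter_filter]
    congr 2
    ext P
    simp only [Finset.mem_filter, Finset.mem_univ, true_and, and_iff_right_iff_imp]
    intro h
    exact Multiset.count_pos.1 (by omega)
  · intro P hP
    have := P.count_mul_le_s13 1
    exact Finset.mem_Icc.2
      ⟨Multiset.count_pos.2 (Finset.mem_filter.1 hP).2, by simpa using this⟩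

end Nat.Partition

theorem Nat.sum_totient_Icc_two_dvd {n m : ℕ} (hm : 1 ≤ m) (hmn : m ≤ n) :
    ∑ k ∈ Icc 2 n with k ∣ m, Nat.totient k = m - 1 := by
  have h : {k ∈ Icc 2 n | k ∣ m} = m.divisors.erase 1 := by
    ext k
    simp only [Finset.mem_filter, Finset.mem_Icc, Finset.mem_erase, Nat.mem_divisors]
    constructor
    · rintro ⟨⟨h2, -⟩, hd⟩
      exact ⟨by omega, hd, by omega⟩
    · rintro ⟨h1, hd, -⟩
      have := Nat.pos_of_dvd_of_pos hd hm
      have := Nat.le_of_dvd hm hd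
      exact ⟨⟨by omega, by omega⟩, hd⟩
  have hsum := Finset.add_sum_erase m.divisors Nat.totient (Nat.one_mem_divisors.2 (by omega))
  rw [Nat.sum_totient, Nat.totient_one] at hsum
  rw [h]
  omega

/-- the sum of `m_1(λ) − 1` over partitions `λ` of `n`
containing 1 as a part equals the sum of `Σ_{k=2}^{n} φ(k)·m_k(μ)` over
partitions `μ` of `n` with no part equal to 1. -/
theorem ones_bijection_identity (n : ℕ) (hn : 0 < n) :
    ∑ P ∈ Finset.univ.filter (fun P : n.Partition => 1 ∈ P.parts),
        (Multiset.count 1 P.parts - 1)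
      = ∑ P ∈ Finset.univ.filter (fun P : n.Partition => 1 ∉ P.parts),
          ∑ k ∈ Finset.Icc 2 n, Nat.totient k * Multiset.count k P.parts := by
  rw [Nat.Partition.sum_count_one_sub_one, Finset.sum_comm]
  have hk : ∀ k ∈ Icc 2 n,
      ∑ P : n.Partition with 1 ∉ P.parts, Nat.totient k * P.parts.count k =
        ∑ m ∈ Icc 1 n, if k ∣ m then
          Nat.totient k * #{Q : (n - m).Partition | 1 ∉ Q.parts} else 0 := fun k hk => by
    rw [← Finset.mul_sum, Nat.Partition.sum_count_of_one_notMem (Finset.mem_Icc.1 hk).1,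
      Finset.mul_sum, Finset.sum_filter]
  rw [Finset.sum_congr rfl hk, Finset.sum_comm]
  refine Finset.sum_congr rfl fun m hm => ?_
  obtain ⟨h1, hmn⟩ := Finset.mem_Icc.1 hm
  rw [← Finset.sum_filter, ← Finset.sum_mul, Nat.sum_totient_Icc_two_dvd h1 hmn]
end
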